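/- arXiv:2312.03526 — 3 statements merged into one kernel-verified Lean document; each statement's English description precedes it below -/
import Mathlib

section
/- Non-negativity of 𝒱-information: if the predictive family 𝒱 is nonempty and satisfies optional ignorance, then for every joint PMF μ on 𝒳 × 𝒴 one has H_𝒱(Y|X) ≤ H_𝒱(Y|∅); equivalently, the 𝒱-information satisfies I_𝒱(X→Y) ≥ 0. -/
open scoped BigOperators

/-- The no-side-information predictive `𝒱`-entropy `H_𝒱(Y | ∅)`. -/
noncomputable def predEntEmpty {X Y : Type*} [Fintype X] [Fintype Y]
    (V : Set (Option X → PMF Y)) (μ : PMF (X × Y)) : ℝ :=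
  ⨅ f : V, ∑ y, ((μ.map Prod.snd) y).toReal * (-Real.log ((f.1 none y).toReal))

/-- The conditional predictive `𝒱`-entropy `H_𝒱(Y | X)`. -/
noncomputable def predEntCond {X Y : Type*} [Fintype X] [Fintype Y]
    (V : Set (Option X → PMF Y)) (μ : PMF (X × Y)) : ℝ :=
  ⨅ f : V, ∑ p : X × Y, (μ p).toReal * (-Real.log ((f.1 (some p.1) p.2).toReal))

/-- Optional ignorance: for every `f ∈ 𝒱` and every `P` in the range of `f`,
some `f' ∈ 𝒱` predicts `P` regardless of (presence of) side information. -/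
def OptionalIgnorance {X Y : Type*} (V : Set (Option X → PMF Y)) : Prop :=
  ∀ f ∈ V, ∀ P ∈ Set.range f, ∃ f' ∈ V, (∀ x : X, f' (some x) = P) ∧ f' none = P

theorem PMF.toReal_map_snd_apply {X Y : Type*} [Fintype X] (μ : PMF (X × Y)) (y : Y) :
    ((μ.map Prod.snd) y).toReal = ∑ x, (μ (x, y)).toReal := by
  classical
  rw [PMF.map_apply, ENNReal.tsum_prod', tsum_fintype,
    ENNReal.toReal_sum fun x _ => ?_]
  · simp
  · simpa using μ.apply_ne_top (x, y)

theorem PMF.sum_toReal_mul_comp_snd {X Y : Type*} [Fintype X] [Fintype Y]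
    (μ : PMF (X × Y)) (g : Y → ℝ) :
    ∑ p : X × Y, (μ p).toReal * g p.2 = ∑ y, ((μ.map Prod.snd) y).toReal * g y := by
  simp only [Fintype.sum_prod_type_right, PMF.toReal_map_snd_apply, Finset.sum_mul]

theorem bddBelow_range_condRisk {X Y : Type*} [Fintype X] [Fintype Y]
    (V : Set (Option X → PMF Y)) (μ : PMF (X × Y)) :
    BddBelow (Set.range fun f : V =>
      ∑ p : X × Y, (μ p).toReal * (-Real.log ((f.1 (some p.1) p.2).toReal))) := by
  refine ⟨0, ?_⟩
  rintro _ ⟨f, rfl⟩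
  refine Finset.sum_nonneg fun p _ => mul_nonneg ENNReal.toReal_nonneg ?_
  exact neg_nonneg.2 (Real.log_nonpos ENNReal.toReal_nonneg
    (ENNReal.toReal_le_of_le_ofReal zero_le_one (by simpa using PMF.coe_le_one _ _)))

/-- Non-negativity of `𝒱`-information: `H_𝒱(Y|X) ≤ H_𝒱(Y|∅)`,
i.e. `I_𝒱(X → Y) = H_𝒱(Y|∅) - H_𝒱(Y|X) ≥ 0`. -/
theorem vInformation_nonneg {X Y : Type*} [Fintype X] [Fintype Y]
    [Nonempty X] [Nonempty Y]
    (V : Set (Option X → PMF Y)) (hV : V.Nonempty) (hOI : OptionalIgnorance V)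
    (μ : PMF (X × Y)) :
    predEntCond V μ ≤ predEntEmpty V μ := by
  have : Nonempty V := hV.to_subtype
  refine le_ciInf fun f => ?_
  obtain ⟨f', hf', hsome, -⟩ := hOI f.1 f.2 (f.1 none) ⟨none, rfl⟩
  refine (ciInf_le (bddBelow_range_condRisk V μ) ⟨f', hf'⟩).trans_eq ?_
  simp only [hsome]
  exact μ.sum_toReal_mul_comp_snd fun y => -Real.log ((f.1 none y).toReal)
end

section
/- Independence implies zero 𝒱-information: if the predictive family 𝒱 is nonempty and satisfies optional ignorance, and the joint PMF μ on 𝒳 × 𝒴 is a product measure, i.e. μ (x,y) = μ_X x · μ_Y y for all x ∈ 𝒳 and y ∈ 𝒴, then H_𝒱(Y|X) = H_𝒱(Y|∅); equivalently I_𝒱(X→Y) = 0. -/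
open scoped BigOperators

/-- The cross-entropy of `P` relative to `q`, in the convention `Real.log 0 = 0`. -/
noncomputable def PMF.crossEntropy {Y : Type*} [Fintype Y] (q P : PMF Y) : ℝ :=
  ∑ y, (q y).toReal * (-Real.log (P y).toReal)

lemma PMF.crossEntropy_nonneg {Y : Type*} [Fintype Y] (q P : PMF Y) : 0 ≤ q.crossEntropy P :=
  Finset.sum_nonneg fun y _ => mul_nonneg ENNReal.toReal_nonneg <| neg_nonneg.2 <|
    Real.log_nonpos ENNReal.toReal_nonneg <|
      ENNReal.toReal_le_of_le_ofReal zero_le_one (by simpa using P.coe_le_one y)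

lemma PMF.sum_toReal_eq_one {X : Type*} [Fintype X] (p : PMF X) : ∑ x, (p x).toReal = 1 := by
  rw [← ENNReal.toReal_sum fun x _ => p.apply_ne_top x,
    ← tsum_fintype (L := .unconditional X), p.tsum_coe, ENNReal.toReal_one]

/-- If the joint law is the product of `p` and `q`, the conditional log-loss is the average over
`p` of the cross-entropies of the conditional predictions relative to `q`. -/
lemma sum_logLoss_eq_sum_crossEntropy {X Y : Type*} [Fintype X] [Fintype Y]
    {μ : PMF (X × Y)} {p : PMF X} {q : PMF Y} (h : ∀ x y, μ (x, y) = p x * q y)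
    (g : X → PMF Y) :
    ∑ z : X × Y, (μ z).toReal * (-Real.log (g z.1 z.2).toReal) =
      ∑ x, (p x).toReal * q.crossEntropy (g x) := by
  simp only [Fintype.sum_prod_type, PMF.crossEntropy, Finset.mul_sum, h, ENNReal.toReal_mul,
    mul_assoc]

/-- Independence implies zero `𝒱`-information: if the joint PMF `μ` is the product of
its marginals, then `H_𝒱(Y|X) = H_𝒱(Y|∅)`, i.e. `I_𝒱(X → Y) = 0`. -/
theorem vInformation_eq_zero_of_indep {X Y : Type*} [Fintype X] [Fintype Y]
    [Nonempty X] [Nonempty Y]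
    (V : Set (Option X → PMF Y)) (hV : V.Nonempty) (hOI : OptionalIgnorance V)
    (μ : PMF (X × Y))
    (hindep : ∀ x : X, ∀ y : Y, μ (x, y) = (μ.map Prod.fst) x * (μ.map Prod.snd) y) :
    predEntCond V μ = predEntEmpty V μ := by
  have : Nonempty V := hV.to_subtype
  change (⨅ f : V, ∑ p : X × Y, (μ p).toReal * (-Real.log (f.1 (some p.1) p.2).toReal)) =
    ⨅ f : V, (μ.map Prod.snd).crossEntropy (f.1 none)
  simp only [fun f : V => sum_logLoss_eq_sum_crossEntropy hindep fun x => f.1 (some x)]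
  set p := μ.map Prod.fst
  set q := μ.map Prod.snd
  apply le_antisymm
  · refine le_ciInf fun f => ?_
    obtain ⟨f', hf', hsome, -⟩ := hOI f.1 f.2 (f.1 none) ⟨none, rfl⟩
    refine ciInf_le_of_le ⟨0, ?_⟩ ⟨f', hf'⟩ ?_
    · rintro _ ⟨g, rfl⟩
      exact Finset.sum_nonneg fun x _ =>
        mul_nonneg ENNReal.toReal_nonneg (q.crossEntropy_nonneg _)
    · simp only [hsome, ← Finset.sum_mul, p.sum_toReal_eq_one, one_mul, le_refl]
  · refine le_ciInf fun f => ?_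
    obtain ⟨x₀, hx₀⟩ := Finite.exists_min fun x => q.crossEntropy (f.1 (some x))
    obtain ⟨f', hf', -, hnone⟩ := hOI f.1 f.2 (f.1 (some x₀)) ⟨some x₀, rfl⟩
    refine ciInf_le_of_le ⟨0, ?_⟩ ⟨f', hf'⟩ ?_
    · rintro _ ⟨g, rfl⟩
      exact q.crossEntropy_nonneg _
    · calc q.crossEntropy (f' none)
          = ∑ x, (p x).toReal * q.crossEntropy (f.1 (some x₀)) := by
            rw [hnone, ← Finset.sum_mul, p.sum_toReal_eq_one, one_mul]
        _ ≤ ∑ x, (p x).toReal * q.crossEntropy (f.1 (some x)) :=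
            Finset.sum_le_sum fun x _ =>
              mul_le_mul_of_nonneg_left (hx₀ x) ENNReal.toReal_nonneg
end

section
/- Reduction of 𝒱-information to Shannon mutual information for the unrestricted observer family (the paper's claim that 𝒱-information reduces to Shannon information when 𝒱 is unbounded): let 𝒳, 𝒴 be finite nonempty types, μ a joint PMF on 𝒳 × 𝒴 with marginals μ_X, μ_Y, and let Ω be the predictive family of all functions f : Option 𝒳 → PMF 𝒴 whose values are strictly positive PMFs. Then H_Ω(Y|∅) = H(μ_Y), H_Ω(Y|X) = ∑_{(x,y) with μ (x,y) > 0} (μ (x,y)) · (− Real.log (μ (x,y) / μ_X x)) (the Shannon conditional entropy H(Y|X)), and consequently I_Ω(X→Y) = ∑_{(x,y) with μ (x,y) > 0} (μ (x,y)) · Real.log (μ (x,y) / (μ_X x · μ_Y y)), the Shannon mutual information I(X;Y). -/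
open scoped BigOperators Classical

/-- Shannon entropy `H(ν) = ∑ z, ν z * (− log (ν z))`. -/
noncomputable def shannonEnt {Z : Type*} [Fintype Z] (ν : PMF Z) : ℝ :=
  ∑ z, (ν z).toReal * (-Real.log ((ν z).toReal))

theorem PMF.sum_toReal {Z : Type*} [Fintype Z] (p : PMF Z) : ∑ z, (p z).toReal = 1 := by
  rw [← ENNReal.toReal_sum fun z _ => p.apply_ne_top z, ← tsum_fintype (L := .unconditional _),
    p.tsum_coe, ENNReal.toReal_one]

theorem PMF.exists_toReal_eq {Z : Type*} [Fintype Z] (r : Z → ℝ) (hr : ∀ z, 0 ≤ r z)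
    (h : ∑ z, r z = 1) : ∃ p : PMF Z, ∀ z, (p z).toReal = r z := by
  refine ⟨PMF.ofFintype (fun z => ENNReal.ofReal (r z)) ?_, fun z => ?_⟩
  · rw [← ENNReal.ofReal_sum_of_nonneg fun z _ => hr z, h, ENNReal.ofReal_one]
  · rw [PMF.ofFintype_apply, ENNReal.toReal_ofReal (hr z)]

theorem PMF.map_fst_toReal {X Y : Type*} [Fintype X] [Fintype Y] (μ : PMF (X × Y)) (x : X) :
    ((μ.map Prod.fst) x).toReal = ∑ y, (μ (x, y)).toReal := by
  rw [PMF.map_apply, tsum_fintype, Fintype.sum_prod_type, Finset.sum_eq_single x,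
    ← ENNReal.toReal_sum fun y _ => μ.apply_ne_top _]
  · simp
  · intro b _ hb
    simp [Ne.symm hb]
  · simp

theorem PMF.map_snd_toReal {X Y : Type*} [Fintype X] [Fintype Y] (μ : PMF (X × Y)) (y : Y) :
    ((μ.map Prod.snd) y).toReal = ∑ x, (μ (x, y)).toReal := by
  rw [PMF.map_apply, tsum_fintype, Fintype.sum_prod_type_right, Finset.sum_eq_single y,
    ← ENNReal.toReal_sum fun x _ => μ.apply_ne_top _]
  · simp
  · intro b _ hb
    simp [Ne.symm hb]
  · simp

/-- Gibbs' inequality for unnormalized weights. -/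
theorem sum_mul_neg_log_div_sum_le {Y : Type*} [Fintype Y] (w q : Y → ℝ) (hw : ∀ y, 0 ≤ w y)
    (hq : ∀ y, 0 < q y) (hq1 : ∑ y, q y = 1) :
    ∑ y, w y * -Real.log (w y / ∑ z, w z) ≤ ∑ y, w y * -Real.log (q y) := by
  set s := ∑ z, w z with hs
  have key : ∀ y, w y * -Real.log (w y / s) ≤ w y * -Real.log (q y) + (q y * s - w y) := by
    intro y
    rcases (hw y).eq_or_lt with h | h
    · have : 0 ≤ q y * s := mul_nonneg (hq y).le (Finset.sum_nonneg fun z _ => hw z)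
      simpa [← h] using this
    · have hs0 : 0 < s := h.trans_le (Finset.single_le_sum (fun z _ => hw z) (Finset.mem_univ y))
      have hlog := Real.log_le_sub_one_of_pos (div_pos (mul_pos (hq y) hs0) h)
      rw [Real.log_div (mul_pos (hq y) hs0).ne' h.ne', Real.log_mul (hq y).ne' hs0.ne'] at hlog
      have hmul := mul_le_mul_of_nonneg_left hlog h.le
      rw [mul_sub (w y) (_ / _) 1, mul_div_cancel₀ _ h.ne'] at hmul
      rw [Real.log_div h.ne' hs0.ne']
      linarith
  calc ∑ y, w y * -Real.log (w y / s)
      ≤ ∑ y, (w y * -Real.log (q y) + (q y * s - w y)) := Finset.sum_le_sum fun y _ => key y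
    _ = ∑ y, w y * -Real.log (q y) := by
      rw [Finset.sum_add_distrib, Finset.sum_sub_distrib, ← Finset.sum_mul, hq1, ← hs]
      ring

open Filter Topology in
theorem tendsto_mul_neg_log_add_div {w s : ℝ} (c : ℝ) (hw : 0 ≤ w) (hs : w ≤ s) :
    Tendsto (fun t => w * -Real.log ((w + t) / (s + t * c))) (𝓝[>] 0)
      (𝓝 (w * -Real.log (w / s))) := by
  rcases hw.eq_or_lt with rfl | h
  · simp
  · have hs0 : s ≠ 0 := (h.trans_le hs).ne'
    have hc : ContinuousAt (fun t => w * -Real.log ((w + t) / (s + t * c))) 0 := by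
      refine continuousAt_const.mul (ContinuousAt.neg (ContinuousAt.log ?_ ?_))
      · exact ContinuousAt.div (by fun_prop) (by fun_prop) (by simpa using hs0)
      · simpa using ⟨h.ne', hs0⟩
    simpa using hc.tendsto.mono_left nhdsWithin_le_nhds

open Filter Topology in
/-- The minimal weighted log-loss over all strictly positive predictors is attained, in the limit,
by the normalized weights. -/
theorem iInf_logLoss_pos {O Y : Type*} [Fintype O] [Fintype Y] [Nonempty Y] (w : O → Y → ℝ)
    (hw : ∀ o y, 0 ≤ w o y) :
    ⨅ f : {f : O → PMF Y | ∀ o y, 0 < f o y}, ∑ o, ∑ y, w o y * -Real.log (f.1 o y).toReal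
      = ∑ o, ∑ y, w o y * -Real.log (w o y / ∑ z, w o z) := by
  have smooth : ∀ t : ℝ, 0 < t → ∃ f : {f : O → PMF Y | ∀ o y, 0 < f o y},
      ∀ o y, (f.1 o y).toReal = (w o y + t) / (∑ z, w o z + t * Fintype.card Y) := by
    intro t ht
    have hden : ∀ o, 0 < ∑ z, w o z + t * Fintype.card Y := fun o =>
      add_pos_of_nonneg_of_pos (Finset.sum_nonneg fun z _ => hw o z)
        (mul_pos ht (Nat.cast_pos.2 Fintype.card_pos))
    have hpos : ∀ o y, 0 < (w o y + t) / (∑ z, w o z + t * Fintype.card Y) := fun o y =>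
      div_pos (add_pos_of_nonneg_of_pos (hw o y) ht) (hden o)
    have hex : ∀ o, ∃ p : PMF Y, ∀ y,
        (p y).toReal = (w o y + t) / (∑ z, w o z + t * Fintype.card Y) := fun o => by
      refine PMF.exists_toReal_eq _ (fun y => (hpos o y).le) ?_
      rw [← Finset.sum_div, Finset.sum_add_distrib, div_eq_one_iff_eq (hden o).ne']
      simp [mul_comm]
    choose f hf using hex
    refine ⟨⟨f, fun o y => ?_⟩, hf⟩
    have := hpos o y
    rw [← hf, ENNReal.toReal_pos_iff] at this
    exact this.1
  have : Nonempty {f : O → PMF Y | ∀ o y, 0 < f o y} := ⟨(smooth 1 one_pos).choose⟩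
  refine ciInf_eq_of_forall_ge_of_forall_gt_exists_lt (fun f => ?_) fun b hb => ?_
  · exact Finset.sum_le_sum fun o _ => sum_mul_neg_log_div_sum_le (w o) _ (hw o)
      (fun y => ENNReal.toReal_pos (f.2 o y).ne' ((f.1 o).apply_ne_top y)) (f.1 o).sum_toReal
  · have hlim : Tendsto (fun t => ∑ o, ∑ y,
          w o y * -Real.log ((w o y + t) / (∑ z, w o z + t * Fintype.card Y))) (𝓝[>] 0)
        (𝓝 (∑ o, ∑ y, w o y * -Real.log (w o y / ∑ z, w o z))) :=
      tendsto_finsetSum _ fun o _ => tendsto_finsetSum _ fun y _ =>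
        tendsto_mul_neg_log_add_div _ (hw o y)
          (Finset.single_le_sum (fun z _ => hw o z) (Finset.mem_univ y))
    obtain ⟨t, htb, ht⟩ := ((hlim.eventually_lt_const hb).and self_mem_nhdsWithin).exists
    obtain ⟨f, hf⟩ := smooth t ht
    exact ⟨f, by simpa only [hf] using htb⟩

theorem predEntEmpty_pos {X Y : Type*} [Fintype X] [Fintype Y] [Nonempty Y] (μ : PMF (X × Y)) :
    predEntEmpty {f : Option X → PMF Y | ∀ o y, 0 < f o y} μ = shannonEnt (μ.map Prod.snd) := by
  have h := iInf_logLoss_pos (O := Option X) (Y := Y)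
    (fun o y => o.elim ((μ.map Prod.snd) y).toReal fun _ => 0)
    (by rintro (_ | _) y <;> simp)
  simpa [-PMF.map_apply, Fintype.sum_option, predEntEmpty, shannonEnt, PMF.sum_toReal] using h

theorem predEntCond_pos {X Y : Type*} [Fintype X] [Fintype Y] [Nonempty Y] (μ : PMF (X × Y)) :
    predEntCond {f : Option X → PMF Y | ∀ o y, 0 < f o y} μ
      = ∑ p : X × Y, (μ p).toReal *
          -Real.log ((μ p).toReal / ((μ.map Prod.fst) p.1).toReal) := by
  have h := iInf_logLoss_pos (O := Option X) (Y := Y)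
    (fun o y => o.elim 0 fun x => (μ (x, y)).toReal)
    (by rintro (_ | _) y <;> simp)
  simpa [-PMF.map_apply, Fintype.sum_option, predEntCond, Fintype.sum_prod_type, PMF.map_fst_toReal] using h

theorem shannonEnt_map_snd {X Y : Type*} [Fintype X] [Fintype Y] (μ : PMF (X × Y)) :
    shannonEnt (μ.map Prod.snd)
      = ∑ p : X × Y, (μ p).toReal * -Real.log ((μ.map Prod.snd) p.2).toReal := by
  rw [shannonEnt, Fintype.sum_prod_type_right]
  refine Finset.sum_congr rfl fun y _ => ?_
  dsimp only
  rw [← Finset.sum_mul, ← PMF.map_snd_toReal]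

theorem PMF.sum_filter_pos_toReal_mul {Z : Type*} [Fintype Z] (μ : PMF Z) (g : Z → ℝ) :
    ∑ p ∈ Finset.univ.filter (fun p => 0 < μ p), (μ p).toReal * g p
      = ∑ p, (μ p).toReal * g p := by
  refine Finset.sum_filter_of_ne fun p _ hp => pos_iff_ne_zero.2 fun h => hp ?_
  rw [h, ENNReal.toReal_zero, zero_mul]

/-- For the unrestricted observer family `Ω` of all strictly positive predictors,
`𝒱`-information reduces to Shannon mutual information: `H_Ω(Y|∅) = H(μ_Y)`,
`H_Ω(Y|X)` is the Shannon conditional entropy `H(Y|X)`, and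
`I_Ω(X→Y) = H_Ω(Y|∅) − H_Ω(Y|X)` is the Shannon mutual information `I(X;Y)`. -/
theorem vInformation_unrestricted_eq_mutualInformation {X Y : Type*}
    [Fintype X] [Fintype Y] [Nonempty X] [Nonempty Y]
    (μ : PMF (X × Y)) :
    predEntEmpty {f : Option X → PMF Y | ∀ o y, 0 < f o y} μ
        = shannonEnt (μ.map Prod.snd) ∧
    predEntCond {f : Option X → PMF Y | ∀ o y, 0 < f o y} μ
        = ∑ p ∈ Finset.univ.filter (fun p : X × Y => 0 < μ p),
            (μ p).toReal *
              (-Real.log ((μ p).toReal / ((μ.map Prod.fst) p.1).toReal)) ∧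
    predEntEmpty {f : Option X → PMF Y | ∀ o y, 0 < f o y} μ
          - predEntCond {f : Option X → PMF Y | ∀ o y, 0 < f o y} μ
        = ∑ p ∈ Finset.univ.filter (fun p : X × Y => 0 < μ p),
            (μ p).toReal *
              Real.log ((μ p).toReal /
                (((μ.map Prod.fst) p.1).toReal * ((μ.map Prod.snd) p.2).toReal)) := by
  rw [predEntEmpty_pos, predEntCond_pos, PMF.sum_filter_pos_toReal_mul,
    PMF.sum_filter_pos_toReal_mul]
  refine ⟨rfl, rfl, ?_⟩
  rw [shannonEnt_map_snd, ← Finset.sum_sub_distrib]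
  refine Finset.sum_congr rfl fun p _ => ?_
  rcases (ENNReal.toReal_nonneg (a := μ p)).eq_or_lt with h | h
  · simp [← h]
  · have hX : 0 < ((μ.map Prod.fst) p.1).toReal := by
      rw [PMF.map_fst_toReal]
      exact h.trans_le (Finset.single_le_sum (f := fun y => (μ (p.1, y)).toReal)
        (fun _ _ => ENNReal.toReal_nonneg) (Finset.mem_univ p.2))
    have hY : 0 < ((μ.map Prod.snd) p.2).toReal := by
      rw [PMF.map_snd_toReal]
      exact h.trans_le (Finset.single_le_sum (f := fun x => (μ (x, p.2)).toReal)
        (fun _ _ => ENNReal.toReal_nonneg) (Finset.mem_univ p.1))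
    rw [Real.log_div h.ne' hX.ne', Real.log_div h.ne' (mul_pos hX hY).ne',
      Real.log_mul hX.ne' hY.ne']
    ring
end
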